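/- arXiv:math/0101080 — 5 statements merged into one kernel-verified Lean document; each statement's English description precedes it below -/
import Mathlib

section
/- (Carré) Let S be an idempotent semiring with zero 0 and unity 1, and let A be a semi-definite n×n matrix over S. Then for every k ≥ n − 1 one has ⊕_{l=0}^{k} A^l = ⊕_{l=0}^{n−1} A^l; consequently the closure matrix A* = ⊕_{l=0}^{∞} A^l exists and equals ⊕_{l=0}^{n−1} A^l. -/
/-- Canonical partial order on an idempotent semiring: `x ≼ y` iff `x ⊕ y = y`. -/
def sle {S : Type*} [Add S] (x y : S) : Prop := x + y = y

/-- A square matrix over an idempotent semiring is semi-definite if the weight of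
every closed path is `≼ 1`. -/
def IsSemiDefinite {S : Type*} [Semiring S] {n : ℕ} (A : Matrix (Fin n) (Fin n) S) : Prop :=
  ∀ (k : ℕ) (p : ℕ → Fin n), 1 ≤ k → p 0 = p k →
    sle (((List.range k).map (fun t => A (p t) (p (t + 1)))).prod) 1

section PathWeight

variable {S ι : Type*} [IdemSemiring S]

theorem sle_iff_le {x y : S} : sle x y ↔ x ≤ y := add_eq_right_iff_le

theorem sum_le_of_forall_le {α : Type*} (s : Finset α) (f : α → S) {x : S}
    (h : ∀ i ∈ s, f i ≤ x) : ∑ i ∈ s, f i ≤ x :=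
  Finset.sum_induction f (· ≤ x) (fun _ _ ha hb => add_le ha hb) (zero_le (a := x)) h

theorem le_sum_of_mem {α : Type*} {s : Finset α} (f : α → S) {i : α} (hi : i ∈ s) :
    f i ≤ ∑ j ∈ s, f j :=
  Finset.single_le_sum (fun _ _ => zero_le) hi

/-- The weight of the path `p 0, p 1, …, p m`. -/
def pathWeight (A : Matrix ι ι S) (p : ℕ → ι) (m : ℕ) : S :=
  ((List.range m).map (fun t => A (p t) (p (t + 1)))).prod

theorem pathWeight_add (A : Matrix ι ι S) (p : ℕ → ι) (a b : ℕ) :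
    pathWeight A p (a + b) = pathWeight A p a * pathWeight A (fun t => p (a + t)) b := by
  simp [pathWeight, List.range_add, Function.comp_def, add_assoc]

theorem pathWeight_one (A : Matrix ι ι S) (p : ℕ → ι) :
    pathWeight A p 1 = A (p 0) (p 1) := by
  simp [pathWeight]

theorem pathWeight_congr (A : Matrix ι ι S) {p q : ℕ → ι} {m : ℕ}
    (h : ∀ t ≤ m, p t = q t) : pathWeight A p m = pathWeight A q m := by
  unfold pathWeight
  congr 1
  refine List.map_congr_left fun t ht => ?_
  have ht : t < m := List.mem_range.1 ht
  rw [h t ht.le, h (t + 1) ht]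

variable [Fintype ι]

/-- Removing a cycle of weight at most `1` does not decrease the weight of a path. -/
theorem exists_shorter_path (A : Matrix ι ι S)
    (hA : ∀ (k : ℕ) (p : ℕ → ι), 1 ≤ k → p 0 = p k → pathWeight A p k ≤ 1)
    (p : ℕ → ι) {m : ℕ} (hm : Fintype.card ι ≤ m) :
    ∃ r < m, ∃ q : ℕ → ι, q 0 = p 0 ∧ q r = p m ∧ pathWeight A p m ≤ pathWeight A q r := by
  obtain ⟨a, b, hab, hbm, hpab⟩ : ∃ a b, a < b ∧ b ≤ m ∧ p a = p b := by
    obtain ⟨a, b, hne, hp⟩ := Fintype.exists_ne_map_eq_of_card_lt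
      (fun t : Fin (m + 1) => p t) (by simpa using Nat.lt_succ_of_le hm)
    rcases lt_or_gt_of_ne hne with h | h
    · exact ⟨a, b, h, Nat.le_of_lt_succ b.2, hp⟩
    · exact ⟨b, a, h, Nat.le_of_lt_succ a.2, hp.symm⟩
  obtain ⟨d, rfl⟩ := Nat.exists_eq_add_of_lt hab
  obtain ⟨e, rfl⟩ := Nat.exists_eq_add_of_le hbm
  have hq : ∀ t, (if a + t ≤ a then p (a + t) else p (a + t + (d + 1))) = p (a + d + 1 + t) := by
    intro t
    rcases Nat.eq_zero_or_pos t with rfl | ht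
    · simpa using hpab
    · rw [if_neg (by omega)]
      congr 1
      omega
  refine ⟨a + e, by omega, fun t => if t ≤ a then p t else p (t + (d + 1)), by simp, hq e, ?_⟩
  rw [pathWeight_add A p, add_assoc a d 1, pathWeight_add A p, pathWeight_add A _ a e]
  have hcycle := hA (d + 1) (fun t => p (a + t)) (by omega) hpab
  have hhead : pathWeight A (fun t => if t ≤ a then p t else p (t + (d + 1))) a =
      pathWeight A p a := pathWeight_congr A fun t ht => if_pos ht
  simp only [hhead, hq]
  exact mul_le_mul_left (mul_le_of_le_one_right' hcycle) _

variable [DecidableEq ι]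

theorem pathWeight_le_pow (A : Matrix ι ι S) (p : ℕ → ι) (m : ℕ) :
    pathWeight A p m ≤ (A ^ m) (p 0) (p m) := by
  induction m with
  | zero => simp [pathWeight]
  | succ m ih =>
    rw [pathWeight_add, pathWeight_one, pow_succ, Matrix.mul_apply]
    exact (mul_le_mul_left ih _).trans
      (le_sum_of_mem (fun j => (A ^ m) (p 0) j * A j (p (m + 1))) (Finset.mem_univ (p m)))

theorem mul_pow_apply_le (A : Matrix ι ι S) (m : ℕ) {c x : S} {i j : ι}
    (h : ∀ p : ℕ → ι, p 0 = i → p m = j → c * pathWeight A p m ≤ x) :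
    c * (A ^ m) i j ≤ x := by
  induction m generalizing c i with
  | zero =>
    by_cases hij : i = j
    · simpa [pathWeight, hij] using h (fun _ => i) rfl hij
    · simp [hij]
  | succ m ih =>
    rw [pow_succ', Matrix.mul_apply, Finset.mul_sum]
    refine sum_le_of_forall_le _ _ fun k _ => ?_
    rw [← mul_assoc]
    refine ih fun p hp hpm => ?_
    have := h (fun t => Nat.casesOn t i p) rfl hpm
    rw [add_comm m 1, pathWeight_add, pathWeight_one, ← mul_assoc] at this
    simpa [hp, add_comm 1] using this

theorem pow_apply_le (A : Matrix ι ι S) (m : ℕ) {x : S} {i j : ι}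
    (h : ∀ p : ℕ → ι, p 0 = i → p m = j → pathWeight A p m ≤ x) :
    (A ^ m) i j ≤ x := by
  simpa using mul_pow_apply_le A m (c := 1) (by simpa using h)

theorem pathWeight_le_sum_pow (A : Matrix ι ι S)
    (hA : ∀ (k : ℕ) (p : ℕ → ι), 1 ≤ k → p 0 = p k → pathWeight A p k ≤ 1)
    (p : ℕ → ι) (m : ℕ) :
    pathWeight A p m ≤ ∑ l ∈ Finset.range (Fintype.card ι), (A ^ l) (p 0) (p m) := by
  induction m using Nat.strong_induction_on generalizing p with
  | _ m ih =>
    rcases lt_or_ge m (Fintype.card ι) with hm | hm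
    · exact (pathWeight_le_pow A p m).trans
        (le_sum_of_mem (fun l => (A ^ l) (p 0) (p m)) (Finset.mem_range.2 hm))
    · obtain ⟨r, hr, q, hq0, hqr, hle⟩ := exists_shorter_path A hA p hm
      have := ih r hr q
      rw [hq0, hqr] at this
      exact hle.trans this

theorem sum_pow_eq_sum_pow_card (A : Matrix ι ι S)
    (hA : ∀ (k : ℕ) (p : ℕ → ι), 1 ≤ k → p 0 = p k → pathWeight A p k ≤ 1)
    {k : ℕ} (hk : Fintype.card ι ≤ k) :
    ∑ l ∈ Finset.range k, A ^ l = ∑ l ∈ Finset.range (Fintype.card ι), A ^ l := by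
  ext i j
  simp only [Matrix.sum_apply]
  apply le_antisymm
  · refine sum_le_of_forall_le _ _ fun l _ => pow_apply_le A l ?_
    rintro p rfl rfl
    exact pathWeight_le_sum_pow A hA p l
  · exact sum_le_of_forall_le _ _ fun l hl => le_sum_of_mem (fun l => (A ^ l) i j)
      (Finset.range_subset_range.2 hk hl)

end PathWeight

/-- Carré: if `A` is a semi-definite `n × n` matrix over an idempotent
semiring with zero and unity, then for every `k ≥ n - 1` one has
`⊕_{l=0}^{k} A^l = ⊕_{l=0}^{n-1} A^l`; consequently the closure
`A* = ⊕_{l=0}^{∞} A^l` exists and equals `⊕_{l=0}^{n-1} A^l`. -/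
theorem carre_closure {S : Type*} [Semiring S] (hid : ∀ x : S, x + x = x)
    {n : ℕ} (A : Matrix (Fin n) (Fin n) S) (hA : IsSemiDefinite A) :
    ∀ k : ℕ, n - 1 ≤ k →
      ∑ l ∈ Finset.range (k + 1), A ^ l = ∑ l ∈ Finset.range n, A ^ l := by
  intro k hk
  let _ : IdemSemiring S := IdemSemiring.ofSemiring hid
  have h := sum_pow_eq_sum_pow_card A (fun k p hk hp => sle_iff_le.1 (hA k p hk hp))
    (k := k + 1) (by rw [Fintype.card_fin]; omega)
  rwa [Fintype.card_fin] at h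
end

section
/- Let S be an idempotent semiring with canonical partial order ≼, and let x = [x̲, x̄] and y = [y̲, ȳ] be closed intervals in S (so x̲ ≼ x̄ and y̲ ≼ ȳ). Let ⋆ denote either the addition ⊕ or the multiplication ⊙ of S. Then the set x ⋆ y = { a ⋆ b : a ∈ [x̲, x̄], b ∈ [y̲, ȳ] } is contained in the interval [x̲ ⋆ y̲, x̄ ⋆ ȳ]; the bounds x̲ ⋆ y̲ and x̄ ⋆ ȳ themselves belong to x ⋆ y; and [x̲ ⋆ y̲, x̄ ⋆ ȳ] is the least closed interval containing x ⋆ y, i.e. any closed interval [z̲, z̄] with x ⋆ y ⊆ [z̲, z̄] satisfies z̲ ≼ x̲ ⋆ y̲ and x̄ ⋆ ȳ ≼ z̄. -/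
theorem sle_add_add {S : Type*} [AddCommSemigroup S] {a b c d : S}
    (hac : sle a c) (hbd : sle b d) : sle (a + b) (c + d) := by
  unfold sle at *
  rw [add_add_add_comm, hac, hbd]

theorem sle_mul_mul {S : Type*} [NonUnitalSemiring S] (hid : ∀ x : S, x + x = x) {a b c d : S}
    (hac : sle a c) (hbd : sle b d) : sle (a * b) (c * d) := by
  unfold sle at *
  calc a * b + c * d = a * b + (a + c) * (b + d) := by rw [hac, hbd]
    _ = (a * b + a * b) + (a * d + (c * b + c * d)) := by
      simp only [add_mul, mul_add]
      abel
    _ = (a + c) * (b + d) := by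
      rw [hid]
      simp only [add_mul, mul_add]
      abel
    _ = c * d := by rw [hac, hbd]

/-- for closed intervals `x = [x̲, x̄]`, `y = [y̲, ȳ]` in an idempotent
semiring and `⋆ ∈ {⊕, ⊙}`, the set `x ⋆ y` is contained in `[x̲ ⋆ y̲, x̄ ⋆ ȳ]`,
the bounds of this interval belong to `x ⋆ y`, and it is the least closed interval
containing `x ⋆ y`. -/
theorem interval_op_exact {S : Type*} [NonUnitalSemiring S]
    (hid : ∀ x : S, x + x = x)
    (star : S → S → S) (hstar : star = (· + ·) ∨ star = (· * ·))
    (xl xu yl yu : S) (hx : sle xl xu) (hy : sle yl yu) :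
    (∀ a b : S, sle xl a → sle a xu → sle yl b → sle b yu →
      sle (star xl yl) (star a b) ∧ sle (star a b) (star xu yu)) ∧
    (∃ a b : S, (sle xl a ∧ sle a xu) ∧ (sle yl b ∧ sle b yu) ∧ star a b = star xl yl) ∧
    (∃ a b : S, (sle xl a ∧ sle a xu) ∧ (sle yl b ∧ sle b yu) ∧ star a b = star xu yu) ∧
    (∀ zl zu : S, sle zl zu →
      (∀ a b : S, sle xl a → sle a xu → sle yl b → sle b yu →
        sle zl (star a b) ∧ sle (star a b) zu) →
      sle zl (star xl yl) ∧ sle (star xu yu) zu) := by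
  have mono : ∀ a b c d : S, sle a c → sle b d → sle (star a b) (star c d) := by
    intro a b c d hac hbd
    rcases hstar with rfl | rfl
    · exact sle_add_add hac hbd
    · exact sle_mul_mul hid hac hbd
  refine ⟨fun a b h₁ h₂ h₃ h₄ => ⟨mono _ _ _ _ h₁ h₃, mono _ _ _ _ h₂ h₄⟩,
    ⟨xl, yl, ⟨hid xl, hx⟩, ⟨hid yl, hy⟩, rfl⟩,
    ⟨xu, yu, ⟨hx, hid xu⟩, ⟨hy, hid yu⟩, rfl⟩,
    fun zl zu _ h => ⟨(h xl yl (hid xl) hx (hid yl) hy).1, (h xu yu hx (hid xu) hy (hid yu)).2⟩⟩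
end

section
/- Let S be an idempotent semiring that is algebraically closed and in which (x ⊕ y)^n = x^n ⊕ y^n holds for all x, y ∈ S and all n ∈ ℕ. Then the interval extension of S is algebraically closed: for every pair y̲ ≼ ȳ in S and every integer n ≥ 1 there exist z̲, z̄ ∈ S with z̲ ≼ z̄, z̲^n = y̲, and z̄^n = ȳ. -/
/-- if an idempotent semiring `S` is algebraically closed and satisfies
`(x ⊕ y)^n = x^n ⊕ y^n` for all `x, y, n`, then its interval extension is
algebraically closed: every interval `[y̲, ȳ]` has an `n`-th root `[z̲, z̄]`
for every `n ≥ 1`. -/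
theorem interval_extension_alg_closed {S : Type*} [Semiring S]
    (hid : ∀ x : S, x + x = x)
    (halg : ∀ (y : S) (m : ℕ), 1 ≤ m → ∃ x : S, x ^ m = y)
    (hfresh : ∀ (x y : S) (m : ℕ), (x + y) ^ m = x ^ m + y ^ m) :
    ∀ yl yu : S, sle yl yu → ∀ m : ℕ, 1 ≤ m →
      ∃ zl zu : S, sle zl zu ∧ zl ^ m = yl ∧ zu ^ m = yu := by
  intro yl yu h m hm
  obtain ⟨a, rfl⟩ := halg yl m hm
  obtain ⟨b, rfl⟩ := halg yu m hm
  refine ⟨a, a + b, ?_, rfl, (hfresh a b m).trans h⟩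
  rw [sle, ← add_assoc, hid]
end

section
/- Let S be an idempotent semiring with zero 0 and unity 1 satisfying the stabilization condition. Then its strong interval extension satisfies the stabilization condition: if x = [x̲, x̄] is an interval with x̄ ≼ 1 and y = [y̲, ȳ] is an interval with 0 ≺ y̲ ≼ ȳ, then there exists n₀ such that for all n ≥ n₀ both x̲^n ⊕ y̲ = x̲^{n₀} ⊕ y̲ and x̄^n ⊕ ȳ = x̄^{n₀} ⊕ ȳ hold. -/
theorem sle.trans {S : Type*} [AddSemigroup S] {x y z : S} (hxy : sle x y) (hyz : sle y z) :
    sle x z := by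
  unfold sle at *
  rw [← hyz, ← add_assoc, hxy]

theorem sle.ne_zero {S : Type*} [AddZeroClass S] {x y : S} (hxy : sle x y) (hx : x ≠ 0) :
    y ≠ 0 := by
  rintro rfl
  exact hx (by simpa [sle] using hxy)

/-- if an idempotent semiring `S` with zero and unity satisfies the
stabilization condition, then its strong interval extension satisfies the
stabilization condition: for an interval `x = [x̲, x̄]` with `x̄ ≼ 1` and an
interval `y = [y̲, ȳ]` with `0 ≺ y̲ ≼ ȳ`, the sequence `x^n ⊕ y` stabilizes
(on lower and upper bounds simultaneously). -/
theorem strong_interval_extension_stabilization {S : Type*} [Semiring S]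
    (hid : ∀ x : S, x + x = x)
    (hstab : ∀ x y : S, sle x 1 → y ≠ 0 →
      ∃ n₀ : ℕ, ∀ m : ℕ, n₀ ≤ m → x ^ m + y = x ^ n₀ + y)
    (xl xu yl yu : S)
    (hx : sle xl xu) (hxu : sle xu 1)
    (hy : sle yl yu) (hyl : sle 0 yl ∧ yl ≠ 0) :
    ∃ n₀ : ℕ, ∀ m : ℕ, n₀ ≤ m →
      xl ^ m + yl = xl ^ n₀ + yl ∧ xu ^ m + yu = xu ^ n₀ + yu := by
  obtain ⟨nl, hnl⟩ := hstab xl yl (hx.trans hxu) hyl.2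
  obtain ⟨nu, hnu⟩ := hstab xu yu hxu (hy.ne_zero hyl.2)
  refine ⟨max nl nu, fun m hm => ⟨?_, ?_⟩⟩
  · rw [hnl m (le_of_max_le_left hm), hnl _ (le_max_left _ _)]
  · rw [hnu m (le_of_max_le_right hm), hnu _ (le_max_right _ _)]
end

section
/- Let S be an idempotent semiring with zero 0 and unity 1 and canonical partial order ≼ (extended entrywise to matrices). Let A̲ ≼ Ā be n×n matrices with Ā semi-definite, and let B̲ ≼ B̄ be n×s matrices over S. For an n×n matrix M set M* = ⊕_{k=0}^{n−1} M^k. Let Σ_min = { A*B : A is an n×n matrix with A̲ ≼ A ≼ Ā, and B is an n×s matrix with B̲ ≼ B ≼ B̄ }. Then: (i) every X ∈ Σ_min satisfies A̲*B̲ ≼ X ≼ Ā*B̄; (ii) A̲*B̲ ∈ Σ_min and Ā*B̄ ∈ Σ_min; and consequently (iii) the matrix interval [A̲*B̲, Ā*B̄] is the least interval of matrices containing Σ_min: any pair of matrices Z̲ ≼ Z̄ with Σ_min ⊆ { X : Z̲ ≼ X ≼ Z̄ } satisfies Z̲ ≼ A̲*B̲ and Ā*B̄ ≼ Z̄. -/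
/-- Entrywise canonical order on matrices. -/
def mle {S : Type*} [Add S] {m k : ℕ} (A B : Matrix (Fin m) (Fin k) S) : Prop :=
  ∀ i j, sle (A i j) (B i j)

/-- The closure `M* = ⊕_{k=0}^{n-1} M^k` of an `n × n` matrix. -/
def mstar {S : Type*} [Semiring S] {n : ℕ} (M : Matrix (Fin n) (Fin n) S) :
    Matrix (Fin n) (Fin n) S :=
  ∑ l ∈ Finset.range n, M ^ l

theorem mle_iff_add_eq {S : Type*} [Add S] {m k : ℕ} {A B : Matrix (Fin m) (Fin k) S} :
    mle A B ↔ A + B = B :=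
  Matrix.ext_iff

theorem mle_refl {S : Type*} [Add S] (hid : ∀ x : S, x + x = x) {m k : ℕ}
    (A : Matrix (Fin m) (Fin k) S) : mle A A :=
  fun i j => hid (A i j)

theorem mle_mul {S : Type*} [Semiring S] (hid : ∀ x : S, x + x = x) {m k l : ℕ}
    {A A' : Matrix (Fin m) (Fin k) S} {B B' : Matrix (Fin k) (Fin l) S}
    (hA : mle A A') (hB : mle B B') : mle (A * B) (A' * B') := by
  rw [mle_iff_add_eq] at *
  have expand : A' * B' = A * B + (A' * B + A * B' + A' * B') := by
    conv_lhs => rw [← hA, ← hB, Matrix.add_mul, Matrix.mul_add, Matrix.mul_add]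
    abel
  rw [expand, ← add_assoc, mle_iff_add_eq.1 (mle_refl hid (A * B))]

theorem mle_pow {S : Type*} [Semiring S] (hid : ∀ x : S, x + x = x) {n : ℕ}
    {A A' : Matrix (Fin n) (Fin n) S} (hA : mle A A') (l : ℕ) : mle (A ^ l) (A' ^ l) := by
  induction l with
  | zero => simpa only [pow_zero] using mle_refl hid _
  | succ l ih => simpa only [pow_succ] using mle_mul hid ih hA

theorem mle_mstar {S : Type*} [Semiring S] (hid : ∀ x : S, x + x = x) {n : ℕ}
    {A A' : Matrix (Fin n) (Fin n) S} (hA : mle A A') : mle (mstar A) (mstar A') := by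
  rw [mle_iff_add_eq, mstar, mstar, ← Finset.sum_add_distrib]
  exact Finset.sum_congr rfl fun l _ => mle_iff_add_eq.1 (mle_pow hid hA l)

/-- for interval matrices `[A̲, Ā]` (with `Ā` semi-definite) and
`[B̲, B̄]` over an idempotent semiring, the interval `[A̲*B̲, Ā*B̄]` contains the
united minimal solution set `Σ_min = {A*B : A̲ ≼ A ≼ Ā, B̲ ≼ B ≼ B̄}`, its bounds
belong to `Σ_min`, and it is the least matrix interval containing `Σ_min`. -/
theorem exact_outer_interval_estimate {S : Type*} [Semiring S]
    (hid : ∀ x : S, x + x = x)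
    {n s : ℕ}
    (Al Au : Matrix (Fin n) (Fin n) S) (Bl Bu : Matrix (Fin n) (Fin s) S)
    (hA : mle Al Au) (hAu : IsSemiDefinite Au) (hB : mle Bl Bu) :
    (∀ (A : Matrix (Fin n) (Fin n) S) (B : Matrix (Fin n) (Fin s) S),
      mle Al A → mle A Au → mle Bl B → mle B Bu →
      mle (mstar Al * Bl) (mstar A * B) ∧ mle (mstar A * B) (mstar Au * Bu)) ∧
    (∃ (A : Matrix (Fin n) (Fin n) S) (B : Matrix (Fin n) (Fin s) S),
      mle Al A ∧ mle A Au ∧ mle Bl B ∧ mle B Bu ∧ mstar A * B = mstar Al * Bl) ∧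
    (∃ (A : Matrix (Fin n) (Fin n) S) (B : Matrix (Fin n) (Fin s) S),
      mle Al A ∧ mle A Au ∧ mle Bl B ∧ mle B Bu ∧ mstar A * B = mstar Au * Bu) ∧
    (∀ (Zl Zu : Matrix (Fin n) (Fin s) S), mle Zl Zu →
      (∀ (A : Matrix (Fin n) (Fin n) S) (B : Matrix (Fin n) (Fin s) S),
        mle Al A → mle A Au → mle Bl B → mle B Bu →
        mle Zl (mstar A * B) ∧ mle (mstar A * B) Zu) →
      mle Zl (mstar Al * Bl) ∧ mle (mstar Au * Bu) Zu) := by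
  have hAl := mle_refl hid Al
  have hAu' := mle_refl hid Au
  have hBl := mle_refl hid Bl
  have hBu := mle_refl hid Bu
  refine ⟨fun A B h₁ h₂ h₃ h₄ => ⟨mle_mul hid (mle_mstar hid h₁) h₃,
    mle_mul hid (mle_mstar hid h₂) h₄⟩, ⟨Al, Bl, hAl, hA, hBl, hB, rfl⟩,
    ⟨Au, Bu, hA, hAu', hB, hBu, rfl⟩, fun Zl Zu _ h => ⟨?_, ?_⟩⟩
  · exact (h Al Bl hAl hA hBl hB).1
  · exact (h Au Bu hA hAu' hB hBu).2
end
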